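/- Let (η, u, m) be a C¹ solution of the Lagrangian Euler system η_t + (c/m) u_x = 0, u_t + m c η_x + 2(p/m) m_x = 0, m_t = 0, with η > 0, m > 0. Then the Riemann invariants satisfy ∂₊s = (1/(2γ)) (∂₊m/m)(s − r) and ∂₋r = (1/(2γ)) (∂₋m/m)(r − s), where ∂₊m = c m'(x) and ∂₋m = −c m'(x); consequently the normalized invariants satisfy ∂₊s̃ = −(1/(2γ)) (∂₊m/m) r̃ and ∂₋r̃ = −(1/(2γ)) (∂₋m/m) s̃. -/

import Mathlib

open Real

/-- partial derivative in the first (space) variable -/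
noncomputable def pdx (f : ℝ → ℝ → ℝ) (x t : ℝ) : ℝ := deriv (fun x' => f x' t) x
/-- partial derivative in the second (time) variable -/
noncomputable def pdt (f : ℝ → ℝ → ℝ) (x t : ℝ) : ℝ := deriv (fun t' => f x t') t

theorem hasDerivAt_pdx {f : ℝ → ℝ → ℝ} (hf : ContDiff ℝ 1 (fun q : ℝ × ℝ => f q.1 q.2))
    (x t : ℝ) : HasDerivAt (fun x' => f x' t) (pdx f x t) x := by
  have h : Differentiable ℝ (fun x' => f x' t) :=
    (hf.differentiable one_ne_zero).comp (differentiable_id.prodMk (differentiable_const t))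
  exact (h x).hasDerivAt

theorem hasDerivAt_pdt {f : ℝ → ℝ → ℝ} (hf : ContDiff ℝ 1 (fun q : ℝ × ℝ => f q.1 q.2))
    (x t : ℝ) : HasDerivAt (fun t' => f x t') (pdt f x t) t := by
  have h : Differentiable ℝ (fun t' => f x t') :=
    (hf.differentiable one_ne_zero).comp ((differentiable_const x).prodMk differentiable_id)
  exact (h t).hasDerivAt

/-- The relation `K_p = ((γ - 1) / (2γ)) K_c` between the constants of a polytropic gas. -/
theorem pressure_const_eq {K γ Ktau : ℝ} (hK : 0 < K) (hγ : 1 < γ)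
    (hKtau : Ktau = (2 * Real.sqrt (K * γ) / (γ - 1)) ^ ((2:ℝ) / (γ - 1))) :
    K * Ktau ^ (-γ)
      = (γ - 1) / (2 * γ) * (Real.sqrt (K * γ) * Ktau ^ (-((γ + 1) / 2))) := by
  have hγ0 : 0 < γ := by linarith
  have hγ1 : 0 < γ - 1 := by linarith
  have hA : 0 < Real.sqrt (K * γ) := Real.sqrt_pos.2 (by positivity)
  have hA2 : Real.sqrt (K * γ) ^ 2 = K * γ := Real.sq_sqrt (by positivity)
  have hB : 0 < 2 * Real.sqrt (K * γ) / (γ - 1) := by positivity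
  have hpos : 0 < Ktau := by rw [hKtau]; positivity
  have hinv : Ktau ^ (-((γ - 1) / 2)) = (γ - 1) / (2 * Real.sqrt (K * γ)) := by
    rw [hKtau, ← Real.rpow_mul hB.le,
      show (2:ℝ) / (γ - 1) * (-((γ - 1) / 2)) = -1 by field_simp, Real.rpow_neg_one, inv_div]
  rw [show -γ = -((γ + 1) / 2) + -((γ - 1) / 2) by ring, Real.rpow_add hpos, hinv]
  field_simp
  rw [hA2]

/-- The pressure expressed through the sound speed. -/
theorem pressure_eq {γ Kp Kc a b : ℝ} (hγ : 1 < γ) (hb : 0 < b)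
    (hKp : Kp = (γ - 1) / (2 * γ) * Kc) :
    Kp * a ^ 2 * b ^ (2 * γ / (γ - 1))
      = (γ - 1) / (2 * γ) * a * b * (Kc * a * b ^ ((γ + 1) / (γ - 1))) := by
  have hγ1 : γ - 1 ≠ 0 := by linarith
  rw [show 2 * γ / (γ - 1) = (γ + 1) / (γ - 1) + 1 by field_simp; ring, Real.rpow_add hb,
    Real.rpow_one, hKp]
  ring

/-- equations for the Riemann invariants and the normalized
Riemann invariants along characteristics, for C¹ solutions of the Lagrangian
Euler system in the `(η, u, m)` variables. -/
theorem stmt6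
    (K ctau γ : ℝ) (hK : 0 < K) (hctau : 0 < ctau) (hγ : 1 < γ)
    (Ktau Kp Kc : ℝ)
    (hKtau : Ktau = (2 * Real.sqrt (K * γ) / (γ - 1)) ^ ((2:ℝ) / (γ - 1)))
    (hKp : Kp = K * Ktau ^ (-γ))
    (hKc : Kc = Real.sqrt (K * γ) * Ktau ^ (-((γ + 1) / 2)))
    (η u m : ℝ → ℝ → ℝ)
    (hηreg : ContDiff ℝ 1 (fun q : ℝ × ℝ => η q.1 q.2))
    (hureg : ContDiff ℝ 1 (fun q : ℝ × ℝ => u q.1 q.2))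
    (hmreg : ContDiff ℝ 1 (fun q : ℝ × ℝ => m q.1 q.2))
    (hηpos : ∀ x t, 0 < η x t) (hmpos : ∀ x t, 0 < m x t)
    (p c : ℝ → ℝ → ℝ)
    (hp : ∀ x t, p x t = Kp * m x t ^ 2 * η x t ^ (2 * γ / (γ - 1)))
    (hc : ∀ x t, c x t = Kc * m x t * η x t ^ ((γ + 1) / (γ - 1)))
    (heq1 : ∀ x t, pdt η x t + c x t / m x t * pdx u x t = 0)
    (heq2 : ∀ x t, pdt u x t + m x t * c x t * pdx η x t
        + 2 * (p x t / m x t) * pdx m x t = 0)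
    (heq3 : ∀ x t, pdt m x t = 0)
    (s r st rt : ℝ → ℝ → ℝ)
    (hs : ∀ x t, s x t = u x t + m x t * η x t)
    (hr : ∀ x t, r x t = u x t - m x t * η x t)
    (hst : ∀ x t, st x t = m x t ^ (-(1 / (2 * γ))) * s x t)
    (hrt : ∀ x t, rt x t = m x t ^ (-(1 / (2 * γ))) * r x t) :
    ∀ x t,
      (pdt m x t + c x t * pdx m x t = c x t * pdx m x t) ∧
      (pdt m x t - c x t * pdx m x t = -(c x t * pdx m x t)) ∧
      (pdt s x t + c x t * pdx s x t
        = 1 / (2 * γ) * ((pdt m x t + c x t * pdx m x t) / m x t)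
            * (s x t - r x t)) ∧
      (pdt r x t - c x t * pdx r x t
        = 1 / (2 * γ) * ((pdt m x t - c x t * pdx m x t) / m x t)
            * (r x t - s x t)) ∧
      (pdt st x t + c x t * pdx st x t
        = -(1 / (2 * γ)) * ((pdt m x t + c x t * pdx m x t) / m x t) * rt x t) ∧
      (pdt rt x t - c x t * pdx rt x t
        = -(1 / (2 * γ)) * ((pdt m x t - c x t * pdx m x t) / m x t) * st x t) := by
  intro x t
  have hγ0 : γ ≠ 0 := by linarith
  have hm : m x t ≠ 0 := (hmpos x t).ne'
  have hconst : Kp = (γ - 1) / (2 * γ) * Kc := by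
    rw [hKp, hKc]; exact pressure_const_eq hK hγ hKtau
  have hpc : p x t = (γ - 1) / (2 * γ) * m x t * η x t * c x t := by
    rw [hp, hc]; exact pressure_eq hγ (hηpos x t) hconst
  have hηx := hasDerivAt_pdx hηreg x t
  have hηt := hasDerivAt_pdt hηreg x t
  have hux := hasDerivAt_pdx hureg x t
  have hut := hasDerivAt_pdt hureg x t
  have hmx := hasDerivAt_pdx hmreg x t
  have hmt := hasDerivAt_pdt hmreg x t
  obtain rfl : s = fun x t => u x t + m x t * η x t := by ext x t; exact hs x t
  obtain rfl : r = fun x t => u x t - m x t * η x t := by ext x t; exact hr x t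
  obtain rfl : st = fun x t => m x t ^ (-(1 / (2 * γ))) * (u x t + m x t * η x t) := by
    ext x t; exact hst x t
  obtain rfl : rt = fun x t => m x t ^ (-(1 / (2 * γ))) * (u x t - m x t * η x t) := by
    ext x t; exact hrt x t
  have hsx := hux.add (hmx.mul hηx)
  have hst' := hut.add (hmt.mul hηt)
  have hrx := hux.sub (hmx.mul hηx)
  have hrt' := hut.sub (hmt.mul hηt)
  have hpx := hmx.rpow_const (p := -(1 / (2 * γ))) (Or.inl hm)
  have hpt := hmt.rpow_const (p := -(1 / (2 * γ))) (Or.inl hm)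
  have esx : pdx (fun x t => u x t + m x t * η x t) x t = _ := hsx.deriv
  have est : pdt (fun x t => u x t + m x t * η x t) x t = _ := hst'.deriv
  have erx : pdx (fun x t => u x t - m x t * η x t) x t = _ := hrx.deriv
  have ert : pdt (fun x t => u x t - m x t * η x t) x t = _ := hrt'.deriv
  have estx : pdx (fun x t => m x t ^ (-(1 / (2 * γ))) * (u x t + m x t * η x t)) x t = _ :=
    (hpx.mul hsx).deriv
  have estt : pdt (fun x t => m x t ^ (-(1 / (2 * γ))) * (u x t + m x t * η x t)) x t = _ :=
    (hpt.mul hst').deriv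
  have ertx : pdx (fun x t => m x t ^ (-(1 / (2 * γ))) * (u x t - m x t * η x t)) x t = _ :=
    (hpx.mul hrx).deriv
  have ertt : pdt (fun x t => m x t ^ (-(1 / (2 * γ))) * (u x t - m x t * η x t)) x t = _ :=
    (hpt.mul hrt').deriv
  rw [esx, est, erx, ert, estx, estt, ertx, ertt]
  simp only [Pi.add_apply, Pi.sub_apply, Pi.mul_apply, Real.rpow_sub_one hm, heq3 x t]
  have h1 : pdt η x t = -(c x t / m x t * pdx u x t) := by linarith [heq1 x t]
  have h2 : pdt u x t = -(m x t * c x t * pdx η x t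
      + 2 * ((γ - 1) / (2 * γ) * m x t * η x t * c x t / m x t) * pdx m x t) := by
    rw [← hpc]; linarith [heq2 x t]
  rw [h1, h2]
  refine ⟨by ring, by ring, ?_, ?_, ?_, ?_⟩ <;> field_simp <;> ring
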